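/- Let (Ω, 𝒢, P) be a probability space with a filtration (F̃_t)_{t≥0}, and let τ : Ω → [0,∞) be a random variable whose law is atomless (P(τ = T) = 0 for all T ≥ 0). Let 0 = T_0 < T_1 < T_2 < ... be a strictly increasing sequence of update times with T_j → ∞, and set ⌊t⌋ := max{T_j : T_j ≤ t}. For T > 0 let F̃_{T^-} := σ(⋃_{s<T} F̃_s), and define the jump ΔF(T_j) := E[1_{{τ ≤ T_j}} | F̃_{T_j}] − E[1_{{τ < T_j}} | F̃_{T_j^-}]. Then the process M_t := Σ_{j ≥ 1 : T_j ≤ ⌊t⌋} ΔF(T_j), t ≥ 0, is a martingale with respect to (F̃_t)_{t≥0}: each M_t is F̃_t-measurable and integrable, and E[M_t | F̃_s] = M_s almost surely for all 0 ≤ s ≤ t. -/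

import Mathlib

open MeasureTheory ProbabilityTheory

/-- Let `(Ω, 𝒢, P)` be a probability space with a filtration `(F̃_t)_{t≥0}`
and let `τ : Ω → [0,∞)` have atomless law.  Let `0 = T_0 < T_1 < ⋯ → ∞` be update times and
`⌊t⌋ := max {T_j : T_j ≤ t}` (encoded via the index `N t` with `T (N t) ≤ t < T (N t + 1)`).
With `F̃_{T^-} := σ(⋃_{s<T} F̃_s)` and
`ΔF(T_j) := E[1_{τ ≤ T_j} | F̃_{T_j}] − E[1_{τ < T_j} | F̃_{T_j^-}]`, the process
`M_t := Σ_{j ≥ 1, T_j ≤ ⌊t⌋} ΔF(T_j)` is an `(F̃_t)`-martingale: each `M_t` is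
`F̃_t`-measurable and integrable, and `E[M_t | F̃_s] = M_s` a.s. for all `0 ≤ s ≤ t`. -/
theorem stmt_2 {Ω : Type*} {m0 : MeasurableSpace Ω} (P : Measure Ω) [IsProbabilityMeasure P]
    (ℱ : Filtration ℝ m0)
    (τ : Ω → ℝ) (hτ : Measurable τ) (hτ0 : ∀ ω, 0 ≤ τ ω)
    (hatomless : ∀ T : ℝ, 0 ≤ T → P (τ ⁻¹' {T}) = 0)
    (T : ℕ → ℝ) (hT0 : T 0 = 0) (hTmono : StrictMono T)
    (hTtop : Filter.Tendsto T Filter.atTop Filter.atTop)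
    (N : ℝ → ℕ) (hN : ∀ t, 0 ≤ t → T (N t) ≤ t ∧ t < T (N t + 1))
    (Fminus : ℝ → MeasurableSpace Ω)
    (hFminus : ∀ u : ℝ, Fminus u = ⨆ s ∈ Set.Iio u, (ℱ s : MeasurableSpace Ω))
    (ΔF : ℕ → Ω → ℝ)
    (hΔF : ∀ j : ℕ, ΔF j = fun ω =>
      (P[Set.indicator (τ ⁻¹' Set.Iic (T j)) (fun _ => (1 : ℝ)) | ℱ (T j)]) ω
        - (P[Set.indicator (τ ⁻¹' Set.Iio (T j)) (fun _ => (1 : ℝ)) | Fminus (T j)]) ω)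
    (M : ℝ → Ω → ℝ)
    (hM : ∀ t : ℝ, M t = fun ω => ∑ j ∈ Finset.Icc 1 (N t), ΔF j ω) :
    (∀ t, 0 ≤ t → StronglyMeasurable[ℱ t] (M t)) ∧
    (∀ t, 0 ≤ t → Integrable (M t) P) ∧
    (∀ s t, 0 ≤ s → s ≤ t → P[M t | ℱ s] =ᵐ[P] M s) := by
  have hle1 : ∀ j, Fminus (T j) ≤ ℱ (T j) := by
    intro j
    rw [hFminus]
    exact iSup₂_le fun s hs => ℱ.mono (le_of_lt hs)
  have hle2 : ∀ j s, s < T j → ℱ s ≤ Fminus (T j) := by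
    intro j s hs
    rw [hFminus]
    exact le_iSup₂_of_le (f := fun s (_ : s ∈ Set.Iio (T j)) => (ℱ s : MeasurableSpace Ω)) s hs le_rfl
  have hmeas : ∀ j, StronglyMeasurable[ℱ (T j)] (ΔF j) := by
    intro j
    rw [hΔF]
    exact stronglyMeasurable_condExp.sub (stronglyMeasurable_condExp.mono (hle1 j))
  have hint : ∀ j, Integrable (ΔF j) P := by
    intro j
    rw [hΔF]
    exact integrable_condExp.sub integrable_condExp
  have hNle : ∀ t, 0 ≤ t → ∀ j, j ≤ N t → T j ≤ t := fun t ht j hj =>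
    (hTmono.monotone hj).trans (hN t ht).1
  have hNlt : ∀ t, 0 ≤ t → ∀ j, N t < j → t < T j := fun t ht j hj =>
    (hN t ht).2.trans_le (hTmono.monotone hj)
  have hMsum : ∀ t, M t = ∑ j ∈ Finset.Icc 1 (N t), ΔF j := by
    intro t
    rw [hM]
    ext ω
    simp
  have hM1 : ∀ t, 0 ≤ t → StronglyMeasurable[ℱ t] (M t) := by
    intro t ht
    rw [hMsum]
    refine Finset.stronglyMeasurable_sum _ fun j hj => ?_
    exact (hmeas j).mono (ℱ.mono (hNle t ht j (Finset.mem_Icc.1 hj).2))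
  have hM2 : ∀ t, 0 ≤ t → Integrable (M t) P := by
    intro t ht
    rw [hMsum]
    exact integrable_finset_sum' _ fun j _ => hint j
  have hzero : ∀ j s, s < T j → P[ΔF j | ℱ s] =ᵐ[P] 0 := by
    intro j s hs
    by_cases hj : 0 ≤ T j
    swap
    · exact absurd (hT0 ▸ hTmono.monotone (Nat.zero_le j)) hj
    have hae : Set.indicator (τ ⁻¹' Set.Iic (T j)) (fun _ => (1 : ℝ)) =ᵐ[P]
        Set.indicator (τ ⁻¹' Set.Iio (T j)) (fun _ => (1 : ℝ)) := by
      have h0 : ∀ᵐ ω ∂P, ω ∉ τ ⁻¹' {T j} := measure_eq_zero_iff_ae_notMem.1 (hatomless _ hj)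
      filter_upwards [h0] with ω hω
      have hne : τ ω ≠ T j := hω
      by_cases h : τ ω < T j
      · simp [Set.indicator, h, h.le]
      · have h' : ¬ τ ω ≤ T j := fun h2 => h (lt_of_le_of_ne h2 hne)
        simp [Set.indicator, h, h']
    have h1 := condExp_condExp_of_le (μ := P)
      (f := Set.indicator (τ ⁻¹' Set.Iic (T j)) (fun _ => (1 : ℝ)))
      (ℱ.mono hs.le) (ℱ.le (T j))
    have h2 := condExp_condExp_of_le (μ := P)
      (f := Set.indicator (τ ⁻¹' Set.Iio (T j)) (fun _ => (1 : ℝ)))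
      (hle2 j s hs) ((hle1 j).trans (ℱ.le (T j)))
    have h3 := condExp_congr_ae (m := ℱ s) hae
    have h4 := condExp_sub (μ := P)
      (f := P[Set.indicator (τ ⁻¹' Set.Iic (T j)) (fun _ => (1 : ℝ)) | ℱ (T j)])
      (g := P[Set.indicator (τ ⁻¹' Set.Iio (T j)) (fun _ => (1 : ℝ)) | Fminus (T j)])
      integrable_condExp integrable_condExp (ℱ s)
    have h5 : ΔF j = P[Set.indicator (τ ⁻¹' Set.Iic (T j)) (fun _ => (1 : ℝ)) | ℱ (T j)]
      - P[Set.indicator (τ ⁻¹' Set.Iio (T j)) (fun _ => (1 : ℝ)) | Fminus (T j)] := hΔF j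
    rw [h5]
    filter_upwards [h1, h2, h3, h4] with ω h1 h2 h3 h4
    rw [h4, Pi.sub_apply, h1, h2, h3]
    simp
  refine ⟨hM1, hM2, fun s t hs hst => ?_⟩
  have ht := hs.trans hst
  have hNst : N s ≤ N t := by
    by_contra! h
    exact absurd (hNlt t ht _ h) (not_lt.2 ((hN s hs).1.trans hst))
  have hsplit : M t = M s + ∑ j ∈ Finset.Ioc (N s) (N t), ΔF j := by
    rw [hMsum, hMsum, ← Finset.sum_union]
    · congr 1
      ext j
      simp only [Finset.mem_Icc, Finset.mem_union, Finset.mem_Ioc]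
      omega
    · rw [Finset.disjoint_left]
      intro j
      simp only [Finset.mem_Icc, Finset.mem_Ioc]
      omega
  have hA := condExp_add (μ := P) (hM2 s hs)
    (integrable_finset_sum' (Finset.Ioc (N s) (N t)) fun j _ => hint j) (ℱ s)
  have hB := condExp_finset_sum (μ := P) (s := Finset.Ioc (N s) (N t)) (f := ΔF)
    (fun j _ => hint j) (ℱ s)
  have hC : ∀ᵐ ω ∂P, ∀ j ∈ Finset.Ioc (N s) (N t), (P[ΔF j | ℱ s]) ω = 0 := by
    rw [Filter.eventually_all_finset]
    exact fun j hj => hzero j s (hNlt s hs j (Finset.mem_Ioc.1 hj).1)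
  rw [hsplit]
  filter_upwards [hA, hB, hC] with ω hA hB hC
  rw [hA, Pi.add_apply, hB, Finset.sum_apply, Finset.sum_eq_zero hC, add_zero,
    condExp_of_stronglyMeasurable (ℱ.le s) (hM1 s hs) (hM2 s hs)]
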